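/- Every set A of n ≥ 2 distinct real numbers satisfies Σ_{d,d' ∈ A−A} r^D_A(d,d')² ≥ 9S⁴ / (256 · C(n,2)⁴), where S = Σ_{d,d' ∈ A−A} r^D_A(d,d') and C(n,2) = n(n−1)/2. -/

import Mathlib

open Finset Pointwise

/-- The (positive) difference set of a finite set of reals:
`A - A = {a - a' : a, a' ∈ A, a - a' > 0}`. -/
noncomputable def diffSet (A : Finset ℝ) : Finset ℝ := (A - A).filter (fun x => 0 < x)

/-- `r^D_A(d,d')`: the number of dumbbells `(a₁,a₂,a₃,a₄) ∈ A⁴` with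
`a₁ < a₂ < a₃ < a₄`, `a₂ - a₁ = a₄ - a₃ = d` and `a₃ - a₂ = d'`. -/
noncomputable def rD (A : Finset ℝ) (d d' : ℝ) : ℕ :=
  ((A ×ˢ A ×ˢ A ×ˢ A).filter fun q =>
    q.1 < q.2.1 ∧ q.2.1 < q.2.2.1 ∧ q.2.2.1 < q.2.2.2 ∧
    q.2.1 - q.1 = d ∧ q.2.2.2 - q.2.2.1 = d ∧ q.2.2.1 - q.2.1 = d').card

/-- The pairs `(x, y)` of elements of `A` with `x < y`. -/
noncomputable def increasingPairs (A : Finset ℝ) : Finset (ℝ × ℝ) :=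
  (A ×ˢ A).filter fun q => q.1 < q.2

/-- The number of representations of `d` as a positive difference of two elements of `A`. -/
noncomputable def diffRep (A : Finset ℝ) (d : ℝ) : ℕ :=
  ((increasingPairs A).filter fun q => q.2 - q.1 = d).card

/-- All dumbbells with endpoints in `A`. -/
noncomputable def dumbbells (A : Finset ℝ) : Finset (ℝ × ℝ × ℝ × ℝ) :=
  (A ×ˢ A ×ˢ A ×ˢ A).filter fun q =>
    q.1 < q.2.1 ∧ q.2.1 < q.2.2.1 ∧ q.2.2.1 < q.2.2.2 ∧ q.2.2.2 - q.2.2.1 = q.2.1 - q.1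

theorem rD_eq_card_filter_dumbbells (A : Finset ℝ) (p : ℝ × ℝ) :
    rD A p.1 p.2 =
      ((dumbbells A).filter fun q => (q.2.1 - q.1, q.2.2.1 - q.2.1) = p).card := by
  unfold rD dumbbells
  congr 1
  ext q
  simp only [mem_filter, Prod.ext_iff]
  constructor
  · rintro ⟨h, h1, h2, h3, h4, h5, h6⟩
    exact ⟨⟨h, h1, h2, h3, h5.trans h4.symm⟩, h4, h6⟩
  · rintro ⟨⟨h, h1, h2, h3, h5⟩, h4, h6⟩
    exact ⟨h, h1, h2, h3, h4, h5.trans h4, h6⟩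

theorem card_increasingPairs (A : Finset ℝ) :
    ((increasingPairs A).card : ℝ) = (A.card : ℝ) * ((A.card : ℝ) - 1) / 2 := by
  have hswap : (A.offDiag.filter fun q => ¬ q.1 < q.2).card = (increasingPairs A).card := by
    refine card_nbij' Prod.swap Prod.swap ?_ ?_ (fun _ _ => rfl) (fun _ _ => rfl)
    · intro q hq
      simp only [increasingPairs, coe_filter, mem_offDiag, mem_product, Set.mem_ofPred_eq,
        Prod.fst_swap, Prod.snd_swap, not_lt] at hq ⊢
      exact ⟨⟨hq.1.2.1, hq.1.1⟩, lt_of_le_of_ne hq.2 (Ne.symm hq.1.2.2)⟩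
    · intro q hq
      simp only [increasingPairs, coe_filter, mem_offDiag, mem_product, Set.mem_ofPred_eq,
        Prod.fst_swap, Prod.snd_swap, not_lt] at hq ⊢
      exact ⟨⟨hq.1.2, hq.1.1, hq.2.ne'⟩, hq.2.le⟩
  have hlt : (A.offDiag.filter fun q => q.1 < q.2) = increasingPairs A := by
    ext q
    simp only [increasingPairs, mem_filter, mem_offDiag, mem_product]
    exact ⟨fun h => ⟨⟨h.1.1, h.1.2.1⟩, h.2⟩, fun h => ⟨⟨h.1.1, h.1.2, h.2.ne⟩, h.2⟩⟩
  have hsum := card_filter_add_card_filter_not (s := A.offDiag) (fun q : ℝ × ℝ => q.1 < q.2)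
  rw [hswap, hlt, offDiag_card] at hsum
  have hle : A.card ≤ A.card * A.card := Nat.le_mul_self _
  have : ((increasingPairs A).card : ℝ) + (increasingPairs A).card
      = A.card * A.card - A.card := by
    rw [← Nat.cast_mul, ← Nat.cast_sub hle, ← hsum, Nat.cast_add]
  linarith

theorem sum_diffRep_le (A s : Finset ℝ) : ∑ d ∈ s, diffRep A d ≤ (increasingPairs A).card :=
  (sum_card_fiberwise_eq_card_filter _ s fun q : ℝ × ℝ => q.2 - q.1).trans_le (card_filter_le _ _)

theorem sum_diffRep_add_le (A s : Finset ℝ) (d : ℝ) :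
    ∑ d' ∈ s, diffRep A (d + d') ≤ (increasingPairs A).card := by
  have h := sum_diffRep_le A (s.map (addLeftEmbedding d))
  simpa using h

theorem sum_rD_le_card_filter (A : Finset ℝ) (s : Finset (ℝ × ℝ)) :
    ∑ p ∈ s, rD A p.1 p.2 ≤
      ((dumbbells A).filter fun q => (q.2.1 - q.1, q.2.2.1 - q.2.1) ∈ s).card := by
  simp only [rD_eq_card_filter_dumbbells]
  exact (sum_card_fiberwise_eq_card_filter _ s _).le

/-- A dumbbell is determined by its two bars of length `d`. -/
theorem sum_rD_fst_le (A : Finset ℝ) (s : Finset (ℝ × ℝ)) (d : ℝ) :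
    ∑ p ∈ s.filter (fun p => p.1 = d), rD A p.1 p.2 ≤ diffRep A d ^ 2 := by
  refine (sum_rD_le_card_filter A _).trans ?_
  rw [sq, diffRep, ← card_product]
  refine card_le_card_of_injOn (fun q => ((q.1, q.2.1), (q.2.2.1, q.2.2.2))) ?_ ?_
  · rintro ⟨a, b, c, e⟩ hq
    simp only [dumbbells, increasingPairs, coe_filter, mem_filter, mem_product,
      Set.mem_ofPred_eq, mem_coe] at hq ⊢
    grind
  · rintro ⟨a, b, c, e⟩ - ⟨a', b', c', e'⟩ - h
    simp only [Prod.mk.injEq] at h ⊢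
    tauto

/-- A dumbbell is determined by its two overlapping segments of length `d + d'`. -/
theorem sum_rD_add_le (A : Finset ℝ) (s : Finset (ℝ × ℝ)) (d : ℝ) :
    ∑ p ∈ s.filter (fun p => p.1 + p.2 = d), rD A p.1 p.2 ≤ diffRep A d ^ 2 := by
  refine (sum_rD_le_card_filter A _).trans ?_
  rw [sq, diffRep, ← card_product]
  refine card_le_card_of_injOn (fun q => ((q.1, q.2.2.1), (q.2.1, q.2.2.2))) ?_ ?_
  · rintro ⟨a, b, c, e⟩ hq
    simp only [dumbbells, increasingPairs, coe_filter, mem_filter, mem_product,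
      Set.mem_ofPred_eq, mem_coe] at hq ⊢
    grind
  · rintro ⟨a, b, c, e⟩ - ⟨a', b', c', e'⟩ - h
    simp only [Prod.mk.injEq] at h ⊢
    tauto

theorem sum_rD_div_diffRep_le (A : Finset ℝ) (s : Finset (ℝ × ℝ)) (f : ℝ × ℝ → ℝ)
    (hf : ∀ d, ∑ p ∈ s.filter (fun p => f p = d), rD A p.1 p.2 ≤ diffRep A d ^ 2) :
    ∑ p ∈ s, (rD A p.1 p.2 : ℝ) / diffRep A (f p) ≤ (increasingPairs A).card := by
  rw [← sum_fiberwise_of_maps_to (t := s.image f) (g := f) fun p hp => mem_image_of_mem f hp]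
  calc ∑ d ∈ s.image f, ∑ p ∈ s.filter (fun p => f p = d),
        (rD A p.1 p.2 : ℝ) / diffRep A (f p)
      ≤ ∑ d ∈ s.image f, (diffRep A d : ℝ) := by
        refine sum_le_sum fun d _ => ?_
        have heq : ∑ p ∈ s.filter (fun p => f p = d), (rD A p.1 p.2 : ℝ) / diffRep A (f p)
            = (∑ p ∈ s.filter (fun p => f p = d), (rD A p.1 p.2 : ℝ)) / diffRep A d := by
          rw [sum_div]
          exact sum_congr rfl fun p hp => by rw [(mem_filter.1 hp).2]
        rw [heq]
        refine div_le_of_le_mul₀ (Nat.cast_nonneg _) (Nat.cast_nonneg _) ?_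
        rw [← sq]
        exact_mod_cast hf d
    _ ≤ (increasingPairs A).card := by exact_mod_cast sum_diffRep_le A _

theorem rD_le_diffRep_fst_sq (A : Finset ℝ) (p : ℝ × ℝ) :
    rD A p.1 p.2 ≤ diffRep A p.1 ^ 2 := by
  simpa [filter_singleton] using sum_rD_fst_le A {p} p.1

theorem rD_le_diffRep_add_sq (A : Finset ℝ) (p : ℝ × ℝ) :
    rD A p.1 p.2 ≤ diffRep A (p.1 + p.2) ^ 2 := by
  simpa [filter_singleton] using sum_rD_add_le A {p} (p.1 + p.2)

theorem sum_diffRep_mul_diffRep_add_le (A s t : Finset ℝ) :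
    ∑ p ∈ s ×ˢ t, (diffRep A p.1 * diffRep A (p.1 + p.2) : ℝ) ≤
      ((increasingPairs A).card : ℝ) ^ 2 := by
  have h : ∑ p ∈ s ×ˢ t, diffRep A p.1 * diffRep A (p.1 + p.2) ≤
      (increasingPairs A).card ^ 2 := by
    rw [sum_product, sq]
    simp only [← mul_sum]
    calc ∑ d ∈ s, diffRep A d * ∑ d' ∈ t, diffRep A (d + d')
        ≤ ∑ d ∈ s, diffRep A d * (increasingPairs A).card :=
          sum_le_sum fun d _ => Nat.mul_le_mul_left _ (sum_diffRep_add_le A t d)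
      _ ≤ (increasingPairs A).card * (increasingPairs A).card := by
          rw [← sum_mul]
          exact Nat.mul_le_mul_right _ (sum_diffRep_le A s)
  exact_mod_cast h

/-- The inequality is two applications of Cauchy-Schwarz, with weights
`√(diffRep A d * diffRep A (d + d'))`. -/
theorem sum_rD_pow_four_le (A s t : Finset ℝ) :
    (∑ p ∈ s ×ˢ t, (rD A p.1 p.2 : ℝ)) ^ 4 ≤
      (∑ p ∈ s ×ˢ t, (rD A p.1 p.2 : ℝ) ^ 2) * ((increasingPairs A).card : ℝ) ^ 4 := by
  set N : ℝ := ((increasingPairs A).card : ℝ)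
  set w : ℝ × ℝ → ℝ := fun p => √(diffRep A p.1) * √(diffRep A (p.1 + p.2))
  have hw : ∀ p, 0 ≤ w p := fun p => by positivity
  have hw2 : ∀ p, w p ^ 2 = diffRep A p.1 * diffRep A (p.1 + p.2) := fun p => by
    rw [mul_pow, Real.sq_sqrt (Nat.cast_nonneg _), Real.sq_sqrt (Nat.cast_nonneg _)]
  have hpos : ∀ p : ℝ × ℝ, rD A p.1 p.2 ≠ 0 →
      0 < (diffRep A p.1 : ℝ) ∧ 0 < (diffRep A (p.1 + p.2) : ℝ) := fun p hp => by
    have h1 := rD_le_diffRep_fst_sq A p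
    have h2 := rD_le_diffRep_add_sq A p
    constructor <;> rw [Nat.cast_pos, Nat.pos_iff_ne_zero] <;> intro h0 <;> simp_all
  have hfirst : (∑ p ∈ s ×ˢ t, (rD A p.1 p.2 : ℝ)) ^ 2 ≤
      (∑ p ∈ s ×ˢ t, rD A p.1 p.2 * w p) * ∑ p ∈ s ×ˢ t, rD A p.1 p.2 / w p := by
    refine sum_sq_le_sum_mul_sum_of_sq_le_mul _ (fun p _ => mul_nonneg (Nat.cast_nonneg _) (hw p))
      (fun p _ => div_nonneg (Nat.cast_nonneg _) (hw p)) fun p _ => Eq.le ?_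
    by_cases hp : rD A p.1 p.2 = 0
    · simp [hp]
    · obtain ⟨h1, h2⟩ := hpos p hp
      have : w p ≠ 0 := by positivity
      field_simp
  have hsecond : (∑ p ∈ s ×ˢ t, rD A p.1 p.2 * w p) ^ 2 ≤
      (∑ p ∈ s ×ˢ t, (rD A p.1 p.2 : ℝ) ^ 2) * N ^ 2 := by
    refine (sum_mul_sq_le_sq_mul_sq _ _ _).trans ?_
    gcongr
    simp only [hw2]
    exact sum_diffRep_mul_diffRep_add_le A s t
  have hthird : ∑ p ∈ s ×ˢ t, rD A p.1 p.2 / w p ≤ N := by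
    have hamgm : ∀ p : ℝ × ℝ, rD A p.1 p.2 / w p ≤
        (rD A p.1 p.2 / diffRep A p.1 + rD A p.1 p.2 / diffRep A (p.1 + p.2) : ℝ) / 2 := by
      intro p
      by_cases hp : rD A p.1 p.2 = 0
      · simp [hp]
      obtain ⟨h1, h2⟩ := hpos p hp
      have h3 := two_mul_le_add_sq (√(diffRep A p.1 : ℝ))⁻¹ (√(diffRep A (p.1 + p.2) : ℝ))⁻¹
      rw [inv_pow, inv_pow, Real.sq_sqrt h1.le, Real.sq_sqrt h2.le] at h3
      have h4 := mul_le_mul_of_nonneg_left h3 (Nat.cast_nonneg (α := ℝ) (rD A p.1 p.2))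
      simp only [w, div_eq_mul_inv, mul_inv]
      linarith
    have h1 := sum_rD_div_diffRep_le A (s ×ˢ t) Prod.fst (sum_rD_fst_le A _)
    have h2 := sum_rD_div_diffRep_le A (s ×ˢ t) (fun p => p.1 + p.2) (sum_rD_add_le A _)
    refine (sum_le_sum fun p _ => hamgm p).trans ?_
    rw [← sum_div, sum_add_distrib]
    linarith
  have hX : 0 ≤ ∑ p ∈ s ×ˢ t, rD A p.1 p.2 * w p :=
    sum_nonneg fun p _ => mul_nonneg (Nat.cast_nonneg _) (hw p)
  calc (∑ p ∈ s ×ˢ t, (rD A p.1 p.2 : ℝ)) ^ 4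
      = ((∑ p ∈ s ×ˢ t, (rD A p.1 p.2 : ℝ)) ^ 2) ^ 2 := by ring
    _ ≤ ((∑ p ∈ s ×ˢ t, rD A p.1 p.2 * w p) * N) ^ 2 := by
        gcongr
        exact hfirst.trans (mul_le_mul_of_nonneg_left hthird hX)
    _ = (∑ p ∈ s ×ˢ t, rD A p.1 p.2 * w p) ^ 2 * N ^ 2 := by ring
    _ ≤ (∑ p ∈ s ×ˢ t, (rD A p.1 p.2 : ℝ) ^ 2) * N ^ 2 * N ^ 2 := by gcongr
    _ = _ := by ring

/-- `Σ_{d,d' ∈ A−A} r^D_A(d,d')² ≥ 9S⁴/(256·C(n,2)⁴)` where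
`S = Σ_{d,d' ∈ A−A} r^D_A(d,d')` and `C(n,2) = n(n−1)/2`. -/
theorem sum_rD_sq_lower (n : ℕ) (hn : 2 ≤ n) (A : Finset ℝ) (hA : A.card = n) :
    9 * (∑ p ∈ diffSet A ×ˢ diffSet A, (rD A p.1 p.2 : ℝ)) ^ 4 /
        (256 * ((n : ℝ) * ((n : ℝ) - 1) / 2) ^ 4) ≤
      ∑ p ∈ diffSet A ×ˢ diffSet A, (rD A p.1 p.2 : ℝ) ^ 2 := by
  have hmain := sum_rD_pow_four_le A (diffSet A) (diffSet A)
  rw [card_increasingPairs, hA] at hmain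
  have hS : 0 ≤ ∑ p ∈ diffSet A ×ˢ diffSet A, (rD A p.1 p.2 : ℝ) ^ 2 := by positivity
  have hN : 0 ≤ ((n : ℝ) * ((n : ℝ) - 1) / 2) ^ 4 := by positivity
  refine div_le_of_le_mul₀ (by positivity) hS ?_
  linarith [mul_nonneg hS hN]
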